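/- arXiv:1805.00244 — 2 statements merged into one kernel-verified Lean document; each statement's English description precedes it below -/
import Mathlib

section
/- Let (W,S), π : G → W, T, and a c-datum c be as in the context, and let c(w̄;ī) be the associated product. Suppose w̄ = (g₁,…,g_n) and w̄' = (g'₁,…,g'_n) are lists of elements of G with each π(g_i), π(g'_i) ∈ S, ī = (i₁<⋯<i_r) and ī' = (i'₁<⋯<i'_r) are index lists, and t, u, t', u' ∈ T, such that: ℓ(π(g₁)⋯π(g_n)) = n and ℓ(π(g'₁)⋯π(g'_n)) = n (the words are reduced); ℓ(π(g_{i₁})⋯π(g_{i_r})) = r and ℓ(π(g'_{i'₁})⋯π(g'_{i'_r})) = r (the selected subwords are reduced); t·g₁⋯g_n = t'·g'₁⋯g'_n in G; and u·g_{i₁}⋯g_{i_r} = u'·g'_{i'₁}⋯g'_{i'_r} in G. Then t·u⁻¹·c(w̄;ī) = t'·u'⁻¹·c(w̄';ī') in ℤ[T]; in other words, t·u⁻¹·c(w̄;ī) depends only on the pair of group elements (t·g₁⋯g_n, u·g_{i₁}⋯g_{i_r}). (This is the paper's Proposition in Section 4.4 establishing the well-definedness of the elements c_w^x ∈ ℤ[Z_k].)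 -/
open MonoidAlgebra

/-- The product `c(w̄;ī)` of Section 4.4 of the paper, where a word together with a
selected subword is encoded as a list of pairs `(g, selected?)`: unselected letters `g`
contribute a factor `c g`, and each selected letter `g` twists everything to its right
by the ring automorphism `σ (π g)`. -/
noncomputable def cWord {G W : Type*} [Group G] [Group W] (π : G →* W)
    (σ : W →* RingAut (MonoidAlgebra ℤ π.ker))
    (c : G → MonoidAlgebra ℤ π.ker) : List (G × Bool) → MonoidAlgebra ℤ π.ker
  | [] => 1
  | (g, false) :: l => c g * cWord π σ c l
  | (g, true) :: l => σ (π g) (cWord π σ c l)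

namespace CoxeterSystem

variable {B W : Type*} [Group W] {M : CoxeterMatrix B} (cs : CoxeterSystem M W)

open Classical in
/-- The action of a simple reflection on `W × ZMod 2`: conjugation on the first factor, and a sign
change on the second factor exactly at the reflection itself. -/
noncomputable def signedConj (i : B) : Function.End (W × ZMod 2) := fun p =>
  (cs.simple i * p.1 * cs.simple i, p.2 + if p.1 = cs.simple i then 1 else 0)

open Classical in
theorem signedConj_mul_pow_apply (i j : B) (k : ℕ) (t : W) (ε : ZMod 2) :
    ((cs.signedConj i * cs.signedConj j) ^ k) (t, ε) =
      ((cs.simple i * cs.simple j) ^ k * t * ((cs.simple i * cs.simple j) ^ k)⁻¹,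
        ε + ∑ q ∈ Finset.range (2 * k),
          if t = cs.simple j * (cs.simple i * cs.simple j) ^ q then 1 else 0) := by
  have hconj : ∀ n : ℕ, ((cs.simple i * cs.simple j) ^ n)⁻¹ * cs.simple j =
      cs.simple j * (cs.simple i * cs.simple j) ^ n := by
    intro n
    induction n with
    | zero => simp
    | succ n ih =>
      rw [pow_succ, mul_inv_rev, mul_assoc, ih, ← pow_succ, pow_succ']
      simp [mul_assoc]
  induction k with
  | zero => simp [Function.End.one_def]
  | succ k ih =>
    rw [pow_succ']
    change cs.signedConj i (cs.signedConj j (((cs.signedConj i * cs.signedConj j) ^ k) (t, ε))) = _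
    rw [ih]
    have h1 : ((cs.simple i * cs.simple j) ^ k * t * ((cs.simple i * cs.simple j) ^ k)⁻¹ =
        cs.simple j) ↔ t = cs.simple j * (cs.simple i * cs.simple j) ^ (2 * k) := by
      rw [mul_inv_eq_iff_eq_mul, ← eq_inv_mul_iff_mul_eq, ← mul_assoc, hconj, mul_assoc,
        ← pow_add, two_mul]
    have h2 : (cs.simple j * ((cs.simple i * cs.simple j) ^ k * t *
        ((cs.simple i * cs.simple j) ^ k)⁻¹) * cs.simple j =
        cs.simple i) ↔ t = cs.simple j * (cs.simple i * cs.simple j) ^ (2 * k + 1) := by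
      have : ∀ x : W, cs.simple j * x * cs.simple j = cs.simple i ↔
          x = cs.simple j * (cs.simple i * cs.simple j) := by
        intro x
        constructor
        · intro h; rw [← h]; simp [mul_assoc]
        · rintro rfl; simp [mul_assoc]
      rw [this, mul_inv_eq_iff_eq_mul, ← eq_inv_mul_iff_mul_eq, ← mul_assoc, ← mul_assoc, hconj,
        mul_assoc, mul_assoc, ← pow_succ', ← pow_add]
      congr! 3
      ring
    rw [show 2 * (k + 1) = 2 * k + 1 + 1 by ring, Finset.sum_range_succ, Finset.sum_range_succ]
    simp only [signedConj, Prod.mk.injEq]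
    refine ⟨by simp [pow_succ', mul_assoc], ?_⟩
    simp only [h1, h2]
    ring

theorem isLiftable_signedConj : M.IsLiftable cs.signedConj := by
  classical
  intro i j
  funext ⟨t, ε⟩
  rw [signedConj_mul_pow_apply, two_mul, Finset.sum_range_add]
  simp [pow_add, CharTwo.add_self_eq_zero, Function.End.one_def]

/-- The representation of `W` on `W × ZMod 2` extending `signedConj`. -/
noncomputable def signedConjHom : W →* Function.End (W × ZMod 2) :=
  cs.lift ⟨cs.signedConj, cs.isLiftable_signedConj⟩

open Classical in
theorem signedConjHom_wordProd_apply (ω : List B) (t : W) (ε : ZMod 2) :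
    cs.signedConjHom (cs.wordProd ω) (t, ε) =
      (cs.wordProd ω * t * (cs.wordProd ω)⁻¹, ε + (cs.rightInvSeq ω).count t) := by
  induction ω with
  | nil => simp [Function.End.one_def]
  | cons i ω ih =>
    have hi : cs.signedConjHom (cs.simple i) = cs.signedConj i := cs.lift_apply_simple _ i
    rw [wordProd_cons, map_mul]
    change cs.signedConjHom (cs.simple i) (cs.signedConjHom (cs.wordProd ω) (t, ε)) = _
    rw [ih, hi]
    have h : (cs.wordProd ω * t * (cs.wordProd ω)⁻¹ = cs.simple i) ↔
        (cs.wordProd ω)⁻¹ * cs.simple i * cs.wordProd ω = t := by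
      rw [mul_inv_eq_iff_eq_mul, ← eq_inv_mul_iff_mul_eq, mul_assoc, eq_comm]
    simp only [signedConj, rightInvSeq, List.count_cons, h, beq_iff_eq]
    simp [mul_assoc, add_assoc]

/-- The exchange property for right descents. -/
theorem exists_mul_simple_eq_eraseIdx {ω : List B} {i : B}
    (h : cs.length (cs.wordProd ω * cs.simple i) < cs.length (cs.wordProd ω)) :
    ∃ j < ω.length, cs.wordProd ω * cs.simple i = cs.wordProd (ω.eraseIdx j) := by
  classical
  obtain ⟨η, hη, hηp⟩ := cs.exists_isReduced (cs.wordProd ω * cs.simple i)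
  have hprod : cs.wordProd (η ++ [i]) = cs.wordProd ω := by
    rw [wordProd_append, ← hηp]; simp
  have hred : cs.IsReduced (η ++ [i]) := by
    have h1 := cs.length_mul_simple (cs.wordProd ω) i
    have h2 := hη.eq
    rw [← hηp] at h2
    rw [IsReduced, hprod, List.length_append, List.length_singleton]
    omega
  have hcount : (cs.rightInvSeq (η ++ [i])).count (cs.simple i) = 1 := by
    apply List.count_eq_one_of_mem hred.nodup_rightInvSeq
    rw [← List.concat_eq_append, rightInvSeq_concat]
    simp
  have h1 := cs.signedConjHom_wordProd_apply ω (cs.simple i) 0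
  rw [← hprod, signedConjHom_wordProd_apply, hcount, hprod] at h1
  have h2 := congrArg Prod.snd h1
  have hmem : cs.simple i ∈ cs.rightInvSeq ω := by
    by_contra hn
    rw [List.count_eq_zero_of_not_mem hn] at h2
    simp at h2
  obtain ⟨j, hj, hje⟩ := List.getElem_of_mem hmem
  refine ⟨j, by simpa using hj, ?_⟩
  rw [← wordProd_mul_getD_rightInvSeq, List.getD_eq_getElem _ _ hj, hje]

/-- The exchange property for left descents. -/
theorem exists_simple_mul_eq_eraseIdx {ω : List B} {i : B}
    (h : cs.length (cs.simple i * cs.wordProd ω) < cs.length (cs.wordProd ω)) :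
    ∃ j < ω.length, cs.simple i * cs.wordProd ω = cs.wordProd (ω.eraseIdx j) := by
  have h' : cs.length (cs.wordProd ω.reverse * cs.simple i) <
      cs.length (cs.wordProd ω.reverse) := by
    rw [wordProd_reverse, ← cs.length_inv, cs.length_inv (cs.wordProd ω)]
    simpa using h
  obtain ⟨j, hj, hje⟩ := cs.exists_mul_simple_eq_eraseIdx h'
  rw [List.length_reverse] at hj
  refine ⟨ω.length - 1 - j, by omega, ?_⟩
  have := congrArg (·⁻¹) hje
  simp only [wordProd_reverse, mul_inv_rev, inv_inv, inv_simple] at this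
  rw [this, ← wordProd_reverse]
  congr 1
  rw [List.eraseIdx_eq_take_drop_succ, List.eraseIdx_eq_take_drop_succ, List.reverse_append,
    List.drop_reverse, List.take_reverse, List.reverse_reverse, List.reverse_reverse]
  congr 2 <;> omega

/-- The alternating word `i, j, i, …` of length `k` starting with `i`. -/
def alternatingFrom : B → B → ℕ → List B
  | _, _, 0 => []
  | i, j, k + 1 => i :: alternatingFrom j i k

@[simp]
theorem length_alternatingFrom (i j : B) (k : ℕ) : (alternatingFrom i j k).length = k := by
  induction k generalizing i j with
  | zero => rfl
  | succ k ih => simp [alternatingFrom, ih]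

theorem exists_alternatingFrom_succ_eq_append (i j : B) (k : ℕ) :
    ∃ e, alternatingFrom i j (k + 1) = alternatingFrom i j k ++ [e] := by
  induction k generalizing i j with
  | zero => exact ⟨i, rfl⟩
  | succ k ih =>
    obtain ⟨e, he⟩ := ih j i
    exact ⟨e, by rw [alternatingFrom, he, alternatingFrom, List.cons_append]⟩

theorem alternatingFrom_prefix (i j : B) {m k : ℕ} (h : m ≤ k) :
    alternatingFrom i j m <+: alternatingFrom i j k := by
  induction k, h using Nat.le_induction with
  | base => exact List.prefix_rfl
  | succ k _ ih =>
    obtain ⟨e, he⟩ := exists_alternatingFrom_succ_eq_append i j k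
    rw [he]
    exact ih.trans (List.prefix_append _ _)

theorem IsReduced.of_cons {cs : CoxeterSystem M W} {i : B} {ω : List B}
    (h : cs.IsReduced (i :: ω)) : cs.IsReduced ω := h.drop 1

theorem IsReduced.of_append_left {cs : CoxeterSystem M W} {ω η : List B}
    (h : cs.IsReduced (ω ++ η)) : cs.IsReduced ω := by
  simpa using h.take ω.length

theorem IsReduced.congr {cs : CoxeterSystem M W} {ω η : List B} (h : cs.IsReduced ω)
    (hp : cs.wordProd η = cs.wordProd ω) (hl : η.length = ω.length) : cs.IsReduced η := by
  rw [IsReduced, hp, hl, h.eq]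

theorem IsReduced.length_eq {cs : CoxeterSystem M W} {ω η : List B} (h : cs.IsReduced ω)
    (h' : cs.IsReduced η) (hp : cs.wordProd η = cs.wordProd ω) : η.length = ω.length := by
  rw [← h.eq, ← h'.eq, hp]

theorem not_isReduced_cons_cons_self (i : B) (ω : List B) : ¬ cs.IsReduced (i :: i :: ω) := by
  intro h
  have h1 := h.eq
  have h2 := cs.length_wordProd_le ω
  simp [wordProd_cons] at h1
  omega

theorem length_wordProd_eraseIdx_alternatingFrom (i j : B) (k p : ℕ) (hp : 0 < p)
    (hpk : p + 1 < k) :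
    cs.length (cs.wordProd ((alternatingFrom i j k).eraseIdx p)) + 3 ≤ k := by
  induction p, hp using Nat.le_induction generalizing i j k with
  | base =>
    obtain ⟨k, rfl⟩ : ∃ n, k = n + 3 := ⟨k - 3, by omega⟩
    have := cs.length_wordProd_le (alternatingFrom j i k)
    simp only [alternatingFrom, List.eraseIdx, wordProd_cons, simple_mul_simple_cancel_left,
      length_alternatingFrom] at this ⊢
    omega
  | succ p hp ih =>
    obtain ⟨k, rfl⟩ : ∃ n, k = n + 1 := ⟨k - 1, by omega⟩
    have h1 := ih j i k (by omega)
    simp only [alternatingFrom, List.eraseIdx_cons_succ, wordProd_cons]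
    have h2 := cs.length_mul_le (cs.simple i) (cs.wordProd ((alternatingFrom j i k).eraseIdx p))
    rw [length_simple] at h2
    omega

theorem IsReduced.eq_alternatingFrom {cs : CoxeterSystem M W} {i j : B} {ω : List B}
    (h : cs.IsReduced ω) (hω : ∀ a ∈ ω, a = i ∨ a = j) :
    ω = alternatingFrom i j ω.length ∨ ω = alternatingFrom j i ω.length := by
  induction ω with
  | nil => exact Or.inl rfl
  | cons a ω ih =>
    have hd : ω ≠ [] → ω.head? ≠ some a := by
      rintro - hh
      cases ω with
      | nil => simp at hh
      | cons b ω =>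
        obtain rfl : b = a := by simpa using hh
        exact cs.not_isReduced_cons_cons_self _ _ h
    cases ω with
    | nil => rcases hω a (by simp) with rfl | rfl <;> simp [alternatingFrom]
    | cons b ω =>
      replace ih := ih h.of_cons fun x hx => hω x (List.mem_cons_of_mem _ hx)
      simp only [List.length_cons, alternatingFrom, List.cons.injEq] at ih ⊢
      have hba : b ≠ a := by simpa using hd
      rcases hω a (by simp) with rfl | rfl <;> rcases ih with ⟨rfl, ih⟩ | ⟨rfl, ih⟩
      · exact absurd rfl hba
      · exact Or.inl ⟨rfl, rfl, ih⟩
      · exact Or.inr ⟨rfl, rfl, ih⟩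
      · exact absurd rfl hba

/-- An element with two distinct left descents has reduced words starting with the two sides of a
braid relation. -/
theorem exists_wordProd_alternatingFrom_append {w : W} {i j : B}
    (hi : cs.IsLeftDescent w i) (hj : cs.IsLeftDescent w j) (hij : cs.simple i ≠ cs.simple j) :
    ∃ k z, cs.wordProd (alternatingFrom i j (k + 1)) = cs.wordProd (alternatingFrom j i (k + 1)) ∧
      cs.wordProd (alternatingFrom i j (k + 1) ++ z) = w ∧
      cs.IsReduced (alternatingFrom i j (k + 1) ++ z) := by
  suffices H : ∀ n k (i j : B) (z : List B), cs.IsLeftDescent w i → cs.IsLeftDescent w j →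
      cs.simple i ≠ cs.simple j → cs.wordProd (alternatingFrom i j k ++ z) = w →
      cs.IsReduced (alternatingFrom i j k ++ z) → z.length = n →
      ∃ k z, cs.wordProd (alternatingFrom i j (k + 1)) =
          cs.wordProd (alternatingFrom j i (k + 1)) ∧
        cs.wordProd (alternatingFrom i j (k + 1) ++ z) = w ∧
        cs.IsReduced (alternatingFrom i j (k + 1) ++ z) by
    obtain ⟨ω, hω, rfl⟩ := cs.exists_isReduced w
    exact H ω.length 0 i j ω hi hj hij rfl hω rfl
  clear hi hj hij i j
  intro n
  induction n using Nat.strong_induction_on with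
  | _ n ih =>
  intro k i j z hi hj hij hw hred hz
  have hj' : cs.length (cs.simple j * cs.wordProd (alternatingFrom i j k ++ z)) <
      cs.length (cs.wordProd (alternatingFrom i j k ++ z)) := by rwa [hw]
  obtain ⟨p, hp, hpe⟩ := cs.exists_simple_mul_eq_eraseIdx hj'
  rw [List.length_append, length_alternatingFrom] at hp
  rcases Nat.lt_or_ge p k with hpk | hpk
  · rw [List.eraseIdx_append_of_lt_length (by simpa using hpk), wordProd_append, wordProd_append,
      ← mul_assoc, mul_left_inj] at hpe
    obtain ⟨k, rfl⟩ : ∃ m, k = m + 1 := ⟨k - 1, by omega⟩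
    refine ⟨k, z, ?_, hw, hred⟩
    rcases Nat.eq_or_lt_of_le (Nat.le_of_lt_succ hpk) with rfl | hlt
    · obtain ⟨e, he⟩ := exists_alternatingFrom_succ_eq_append i j p
      have herase : (alternatingFrom i j (p + 1)).eraseIdx p = alternatingFrom i j p := by
        rw [he, List.eraseIdx_append_of_length_le (by simp)]
        simp
      rw [herase] at hpe
      rw [alternatingFrom.eq_2 j i, wordProd_cons, ← hpe, simple_mul_simple_cancel_left]
    · rcases Nat.eq_zero_or_pos p with rfl | hp0
      · rw [alternatingFrom, List.eraseIdx_zero, List.tail_cons, wordProd_cons, ← mul_assoc,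
          mul_eq_right, mul_eq_one_iff_eq_inv, inv_simple] at hpe
        exact absurd hpe.symm hij
      · have h1 := cs.length_wordProd_eraseIdx_alternatingFrom i j (k + 1) p hp0 (by omega)
        have h2 := hred.of_append_left.eq
        have h3 := cs.length_simple_mul (cs.wordProd (alternatingFrom i j (k + 1))) j
        rw [← hpe] at h1
        rw [length_alternatingFrom] at h2
        omega
  · rw [List.eraseIdx_append_of_length_le (by simpa using hpk), length_alternatingFrom, hw] at hpe
    have hlen : (z.eraseIdx (p - k)).length + 1 = z.length := by
      rw [List.length_eraseIdx_of_lt (by omega)]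
      omega
    have hw' : cs.wordProd (alternatingFrom j i (k + 1) ++ z.eraseIdx (p - k)) = w := by
      rw [alternatingFrom, List.cons_append, wordProd_cons, ← hpe, simple_mul_simple_cancel_left]
    have hred' : cs.IsReduced (alternatingFrom j i (k + 1) ++ z.eraseIdx (p - k)) :=
      hred.congr (hw'.trans hw.symm) (by simp; omega)
    obtain ⟨k', z', h1, h2, h3⟩ :=
      ih (n - 1) (by omega) (k + 1) j i _ hj hi hij.symm hw' hred' (by omega)
    have h4 : cs.wordProd (alternatingFrom i j (k' + 1) ++ z') = w := by
      rw [wordProd_append, ← h1, ← wordProd_append, h2]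
    exact ⟨k', z', h1.symm, h4, h3.congr (h4.trans h2.symm) (by simp)⟩

end CoxeterSystem

/-- The subword of selected letters of a word with marked letters. -/
def selectedWord {α : Type*} (l : List (α × Bool)) : List α :=
  (l.filter fun p => p.2).map Prod.fst

section selectedWord

variable {α : Type*}

@[simp]
theorem selectedWord_nil : selectedWord ([] : List (α × Bool)) = [] := rfl

@[simp]
theorem selectedWord_cons_true (a : α) (l : List (α × Bool)) :
    selectedWord ((a, true) :: l) = a :: selectedWord l := rfl

@[simp]
theorem selectedWord_cons_false (a : α) (l : List (α × Bool)) :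
    selectedWord ((a, false) :: l) = selectedWord l := rfl

@[simp]
theorem selectedWord_append (l l' : List (α × Bool)) :
    selectedWord (l ++ l') = selectedWord l ++ selectedWord l' := by
  simp [selectedWord]

theorem selectedWord_sublist (l : List (α × Bool)) : (selectedWord l).Sublist (l.map Prod.fst) :=
  List.filter_sublist.map _

theorem exists_selectedWord_eq {η ω : List α} (h : η.Sublist ω) :
    ∃ l : List (α × Bool), l.map Prod.fst = ω ∧ selectedWord l = η := by
  induction h with
  | slnil => exact ⟨[], rfl, rfl⟩
  | cons a _ ih =>
    obtain ⟨l, rfl, rfl⟩ := ih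
    exact ⟨(a, false) :: l, rfl, rfl⟩
  | cons_cons a _ ih =>
    obtain ⟨l, rfl, rfl⟩ := ih
    exact ⟨(a, true) :: l, rfl, rfl⟩

@[simp]
theorem map_fst_map_mk_true (ω : List α) : (ω.map fun a => (a, true)).map Prod.fst = ω := by
  simp [Function.comp_def]

@[simp]
theorem selectedWord_map_mk_true (ω : List α) : selectedWord (ω.map fun a => (a, true)) = ω := by
  induction ω with
  | nil => rfl
  | cons a ω ih => simp [ih]

end selectedWord

namespace CoxeterSystem

variable {B W : Type*} [Group W] {M : CoxeterMatrix B} (cs : CoxeterSystem M W)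

/-- A marked word is bireduced if it and its selected subword are both reduced. -/
structure IsBireduced (l : List (B × Bool)) : Prop where
  word : cs.IsReduced (l.map Prod.fst)
  selected : cs.IsReduced (selectedWord l)

/-- Two marked words are parallel if they have the same product and their selected subwords have
the same product. -/
structure IsParallel (l l' : List (B × Bool)) : Prop where
  word : cs.wordProd (l'.map Prod.fst) = cs.wordProd (l.map Prod.fst)
  selected : cs.wordProd (selectedWord l') = cs.wordProd (selectedWord l)

/-- Equivalence relations on marked words compatible with adding letters at both ends and with the
basic moves on selected subwords. -/
structure IsSubwordCongruence (r : List (B × Bool) → List (B × Bool) → Prop) : Prop where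
  refl (l) : r l l
  symm {l l'} : r l l' → r l' l
  trans {l l' l''} : r l l' → r l' l'' → r l l''
  cons {i j : B} (b : Bool) {l l'} : cs.simple i = cs.simple j → r l l' →
    r ((i, b) :: l) ((j, b) :: l')
  concat (a : B × Bool) {l l'} : r l l' → r (l ++ [a]) (l' ++ [a])
  conj {i j : B} {l} : cs.simple i * cs.wordProd (l.map Prod.fst) =
      cs.wordProd (l.map Prod.fst) * cs.simple j → r ((i, false) :: l) (l ++ [(j, false)])
  swap {i j : B} {l} : cs.simple i * cs.wordProd (selectedWord l) =
      cs.wordProd (selectedWord l) * cs.simple j →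
    r ((i, true) :: (l ++ [(j, false)])) ((i, false) :: (l ++ [(j, true)]))
  selectAll {ω ω' : List B} : cs.wordProd ω = cs.wordProd ω' →
    r (ω.map fun i => (i, true)) (ω'.map fun i => (i, true))

variable {cs}

theorem IsParallel.refl (l : List (B × Bool)) : cs.IsParallel l l := ⟨rfl, rfl⟩

theorem IsParallel.symm {l l' : List (B × Bool)} (h : cs.IsParallel l l') :
    cs.IsParallel l' l := ⟨h.word.symm, h.selected.symm⟩

theorem IsParallel.trans {l l' l'' : List (B × Bool)} (h : cs.IsParallel l l')
    (h' : cs.IsParallel l' l'') : cs.IsParallel l l'' :=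
  ⟨h'.word.trans h.word, h'.selected.trans h.selected⟩

theorem IsParallel.append_right {l l' : List (B × Bool)} (h : cs.IsParallel l l')
    (m : List (B × Bool)) : cs.IsParallel (l ++ m) (l' ++ m) :=
  ⟨by simp [wordProd_append, h.word], by simp [wordProd_append, h.selected]⟩

theorem IsParallel.cons {l l' : List (B × Bool)} (h : cs.IsParallel l l')
    {i j : B} (hij : cs.simple i = cs.simple j) (b : Bool) :
    cs.IsParallel ((i, b) :: l) ((j, b) :: l') := by
  refine ⟨by simp [wordProd_cons, h.word, hij], ?_⟩
  cases b <;> simp [wordProd_cons, h.selected, hij]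

theorem IsBireduced.length_eq {l l' : List (B × Bool)} (h : cs.IsBireduced l)
    (h' : cs.IsBireduced l') (hp : cs.IsParallel l l') : l'.length = l.length := by
  simpa using h.word.length_eq h'.word hp.word

theorem IsBireduced.length_selectedWord_eq {l l' : List (B × Bool)} (h : cs.IsBireduced l)
    (h' : cs.IsBireduced l') (hp : cs.IsParallel l l') :
    (selectedWord l').length = (selectedWord l).length :=
  h.selected.length_eq h'.selected hp.selected

theorem IsBireduced.congr {l l' : List (B × Bool)} (h : cs.IsBireduced l)
    (hp : cs.IsParallel l l') (hl : l'.length = l.length)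
    (hs : (selectedWord l').length = (selectedWord l).length) : cs.IsBireduced l' :=
  ⟨h.word.congr hp.word (by simpa using hl), h.selected.congr hp.selected hs⟩

theorem IsBireduced.of_cons {a : B × Bool} {l : List (B × Bool)} (h : cs.IsBireduced (a :: l)) :
    cs.IsBireduced l := by
  refine ⟨h.word.of_cons, ?_⟩
  have := h.selected
  obtain ⟨i, b⟩ := a
  cases b
  · exact this
  · exact this.of_cons

theorem IsBireduced.of_append_left {l m : List (B × Bool)} (h : cs.IsBireduced (l ++ m)) :
    cs.IsBireduced l := by
  have h1 := h.word
  have h2 := h.selected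
  rw [List.map_append] at h1
  rw [selectedWord_append] at h2
  exact ⟨h1.of_append_left, h2.of_append_left⟩

theorem IsReduced.isLeftDescent {i : B} {ω : List B} (h : cs.IsReduced (i :: ω)) :
    cs.IsLeftDescent (cs.wordProd (i :: ω)) i := by
  rw [IsLeftDescent, h.eq, wordProd_cons, simple_mul_simple_cancel_left, h.of_cons.eq]
  simp

namespace IsSubwordCongruence

variable {r : List (B × Bool) → List (B × Bool) → Prop}

theorem append_right (hr : cs.IsSubwordCongruence r) {l l' : List (B × Bool)} (h : r l l')
    (m : List (B × Bool)) : r (l ++ m) (l' ++ m) := by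
  induction m generalizing l l' with
  | nil => simpa
  | cons a m ih => simpa using ih (hr.concat a h)

/-- The two sides of a braid relation carry related markings with any prescribed selected
product. -/
theorem exists_rel_alternatingFrom (hr : cs.IsSubwordCongruence r) {i j : B} {k : ℕ}
    (hb : cs.wordProd (alternatingFrom i j (k + 1)) = cs.wordProd (alternatingFrom j i (k + 1)))
    {η : List B} (hη : cs.IsReduced η) (hs : η.Sublist (alternatingFrom i j (k + 1))) :
    ∃ m m' : List (B × Bool), m.map Prod.fst = alternatingFrom i j (k + 1) ∧
      m'.map Prod.fst = alternatingFrom j i (k + 1) ∧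
      cs.wordProd (selectedWord m) = cs.wordProd η ∧
      cs.wordProd (selectedWord m') = cs.wordProd η ∧
      (selectedWord m).length = η.length ∧ (selectedWord m').length = η.length ∧ r m m' := by
  have key : ∀ i j : B,
      cs.wordProd (alternatingFrom i j (k + 1)) = cs.wordProd (alternatingFrom j i (k + 1)) →
      η.Sublist (alternatingFrom i j k) →
      ∃ m m' : List (B × Bool), m.map Prod.fst = alternatingFrom i j (k + 1) ∧
        m'.map Prod.fst = alternatingFrom j i (k + 1) ∧ selectedWord m = η ∧
        selectedWord m' = η ∧ r m m' := by
    intro i j hb h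
    obtain ⟨l, hl, rfl⟩ := exists_selectedWord_eq h
    obtain ⟨e, he⟩ := exists_alternatingFrom_succ_eq_append i j k
    refine ⟨l ++ [(e, false)], (j, false) :: l, by simp [hl, he], by simp [hl, alternatingFrom],
      by simp, by simp, hr.symm (hr.conj ?_)⟩
    rw [hl, ← wordProd_cons, ← wordProd_singleton, ← wordProd_append, ← he, hb, alternatingFrom]
  have hmem : ∀ (k : ℕ) (i j a : B), a ∈ alternatingFrom i j k → a = i ∨ a = j := by
    intro k
    induction k with
    | zero => simp [alternatingFrom]
    | succ k ih =>
      intro i j a ha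
      rcases List.mem_cons.1 ha with h | h
      · exact Or.inl h
      · exact (ih j i a h).symm
  have hle := hs.length_le
  rw [length_alternatingFrom] at hle
  rcases Nat.eq_or_lt_of_le hle with hlen | hlt
  · obtain rfl := hs.eq_of_length (by simpa using hlen)
    refine ⟨_, _, map_fst_map_mk_true _, map_fst_map_mk_true _, ?_, ?_, ?_, ?_, hr.selectAll hb⟩ <;>
      simp [hb]
  · rcases hη.eq_alternatingFrom fun a ha => hmem _ i j a (hs.subset ha) with h | h
    · obtain ⟨m, m', h1, h2, h3, h4, h5⟩ := key i j hb
        (h ▸ (alternatingFrom_prefix i j (Nat.le_of_lt_succ hlt)).sublist)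
      exact ⟨m, m', h1, h2, by rw [h3], by rw [h4], by rw [h3], by rw [h4], h5⟩
    · obtain ⟨m, m', h1, h2, h3, h4, h5⟩ := key j i hb.symm
        (h ▸ (alternatingFrom_prefix j i (Nat.le_of_lt_succ hlt)).sublist)
      exact ⟨m', m, h2, h1, by rw [h4], by rw [h3], by rw [h4], by rw [h3], hr.symm h5⟩

theorem exists_rel_alternatingFrom_append (hr : cs.IsSubwordCongruence r) {i j : B} {k : ℕ}
    (hb : cs.wordProd (alternatingFrom i j (k + 1)) = cs.wordProd (alternatingFrom j i (k + 1)))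
    {z : List B} {l : List (B × Bool)} (hl : cs.IsBireduced l)
    (hlz : l.map Prod.fst = alternatingFrom i j (k + 1) ++ z) :
    ∃ m m' : List (B × Bool), m.map Prod.fst = alternatingFrom i j (k + 1) ++ z ∧
      m'.map Prod.fst = alternatingFrom j i (k + 1) ++ z ∧ cs.IsBireduced m ∧
      cs.IsBireduced m' ∧ cs.IsParallel l m ∧ cs.IsParallel l m' ∧ r m m' := by
  obtain ⟨l₁, l₂, rfl, h1, rfl⟩ := List.map_eq_append_iff.1 hlz
  obtain ⟨m, m', hm, hm', hX, hX', hL, hL', hrm⟩ := hr.exists_rel_alternatingFrom hb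
    hl.of_append_left.selected (h1 ▸ selectedWord_sublist l₁)
  have hp : cs.IsParallel l₁ m := ⟨by rw [hm, h1], hX⟩
  have hp' : cs.IsParallel l₁ m' := ⟨by rw [hm', h1, hb], hX'⟩
  have e1 := congrArg List.length h1
  have e2 := congrArg List.length hm
  have e3 := congrArg List.length hm'
  simp only [List.length_map, length_alternatingFrom] at e1 e2 e3
  refine ⟨m ++ l₂, m' ++ l₂, by simp [hm], by simp [hm'], hl.congr (hp.append_right _) ?_ ?_,
    hl.congr (hp'.append_right _) ?_ ?_, hp.append_right _, hp'.append_right _,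
    hr.append_right hrm _⟩ <;> simp [e1, e2, e3, hL, hL']

end IsSubwordCongruence

theorem isSubwordCongruence_true : cs.IsSubwordCongruence fun _ _ => True := by
  constructor <;> intros <;> trivial

/-- The subword property: any reduced word of an element contains a reduced word of each element
which is the product of a reduced subword of some reduced word. -/
theorem IsBireduced.exists_isParallel {l : List (B × Bool)} (hl : cs.IsBireduced l)
    {ω : List B} (hω : cs.IsReduced ω) (hp : cs.wordProd ω = cs.wordProd (l.map Prod.fst)) :
    ∃ l', l'.map Prod.fst = ω ∧ cs.IsBireduced l' ∧ cs.IsParallel l l' := by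
  induction hn : l.length generalizing l ω with
  | zero =>
    obtain rfl := List.length_eq_zero_iff.1 hn
    have := hl.word.length_eq hω hp
    obtain rfl : ω = [] := by simpa using this
    exact ⟨[], rfl, hl, .refl _⟩
  | succ n ih =>
    have same : ∀ {l : List (B × Bool)} {ω η : List B} {i j : B}, cs.IsBireduced l →
        cs.IsReduced (j :: ω) → cs.wordProd (j :: ω) = cs.wordProd (l.map Prod.fst) →
        l.length = n + 1 → l.map Prod.fst = i :: η → cs.simple i = cs.simple j →
        ∃ l', l'.map Prod.fst = j :: ω ∧ cs.IsBireduced l' ∧ cs.IsParallel l l' := by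
      intro l ω η i j hl hω hp hn hη hij
      obtain ⟨⟨i', b⟩, l, rfl, hi', rfl⟩ := List.map_eq_cons_iff.1 hη
      obtain rfl : i' = i := hi'
      rw [List.map_cons, wordProd_cons, wordProd_cons, hij, mul_right_inj] at hp
      obtain ⟨l', rfl, hl', hp'⟩ := ih hl.of_cons hω.of_cons hp (by simpa using hn)
      refine ⟨(j, b) :: l', rfl, hl.congr (hp'.cons hij b) ?_ ?_, hp'.cons hij b⟩
      · simpa using hl.of_cons.length_eq hl' hp'
      · cases b <;> simpa using hl.of_cons.length_selectedWord_eq hl' hp'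
    have hlen := hl.word.length_eq hω hp
    cases hlc : l.map Prod.fst with
    | nil => simp at hlc; simp [hlc] at hn
    | cons i η =>
    cases ω with
    | nil => simp [hn] at hlen
    | cons j ω =>
    by_cases hij : cs.simple i = cs.simple j
    · exact same hl hω hp hn hlc hij
    have hi : cs.IsLeftDescent (cs.wordProd (l.map Prod.fst)) i := by
      rw [hlc]
      exact (hlc ▸ hl.word).isLeftDescent
    have hj : cs.IsLeftDescent (cs.wordProd (l.map Prod.fst)) j := hp ▸ hω.isLeftDescent
    obtain ⟨k, z, hb, hz, hzr⟩ := cs.exists_wordProd_alternatingFrom_append hi hj hij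
    obtain ⟨l₂, hl₂, hr₂, hp₂⟩ := same hl hzr hz hn hlc rfl
    obtain ⟨-, l₃, -, hl₃, -, hr₃, -, hp₃, -⟩ :=
      isSubwordCongruence_true.exists_rel_alternatingFrom_append hb hr₂ hl₂
    obtain ⟨l₄, hl₄, hr₄, hp₄⟩ := same hr₃ hω (by rw [hp₃.word, hp₂.word, hp])
      (by rw [hr₂.length_eq hr₃ hp₃, hl.length_eq hr₂ hp₂, hn]) hl₃ rfl
    exact ⟨l₄, hl₄, hr₄, (hp₂.trans hp₃).trans hp₄⟩

theorem IsReduced.of_append_singleton {ω : List B} {b : B} (h : cs.IsReduced (ω ++ [b])) :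
    cs.length (cs.wordProd (ω ++ [b]) * cs.simple b) < cs.length (cs.wordProd (ω ++ [b])) := by
  rw [h.eq, wordProd_append, wordProd_singleton, simple_mul_simple_cancel_right,
    h.of_append_left.eq]
  simp

/-- If the last letter is a right descent of the selected product, then it may be selected. -/
theorem IsBireduced.exists_select_last {p : List (B × Bool)} {b : B} {ε : Bool}
    (h : cs.IsBireduced (p ++ [(b, ε)]))
    (hlt : cs.length (cs.wordProd (selectedWord (p ++ [(b, ε)])) * cs.simple b) <
      cs.length (cs.wordProd (selectedWord (p ++ [(b, ε)])))) :
    ∃ q, q.map Prod.fst = p.map Prod.fst ∧ cs.IsBireduced (q ++ [(b, true)]) ∧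
      cs.IsParallel (p ++ [(b, ε)]) (q ++ [(b, true)]) := by
  cases ε with
  | true => exact ⟨p, rfl, h, .refl _⟩
  | false =>
    have hs : selectedWord (p ++ [(b, false)]) = selectedWord p := by simp
    rw [hs] at hlt
    obtain ⟨j, hj, hje⟩ := cs.exists_mul_simple_eq_eraseIdx hlt
    obtain ⟨q, hq, hqs⟩ := exists_selectedWord_eq
      (((selectedWord p).eraseIdx_sublist j).trans (selectedWord_sublist p))
    have hpar : cs.IsParallel (p ++ [(b, false)]) (q ++ [(b, true)]) :=
      ⟨by simp [hq], by simp [hqs, wordProd_append, ← hje]⟩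
    have hlen := congrArg List.length hq
    have hdel := List.length_eraseIdx_add_one hj
    exact ⟨q, hq, h.congr hpar (by simpa using hlen) (by simp [hqs, hdel]), hpar⟩

/-- If `y < s y` and `y < y s'` but `s y s' < s y`, then `s y = y s'`. -/
theorem simple_mul_eq_mul_simple {y : W} {i j : B}
    (hi : cs.length (cs.simple i * y) = cs.length y + 1)
    (hj : cs.length y < cs.length (y * cs.simple j))
    (h : cs.length (cs.simple i * y * cs.simple j) < cs.length (cs.simple i * y)) :
    cs.simple i * y = y * cs.simple j := by
  obtain ⟨η, hη, rfl⟩ := cs.exists_isReduced y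
  rw [← wordProd_cons] at h
  obtain ⟨p, hp, hpe⟩ := cs.exists_mul_simple_eq_eraseIdx h
  cases p with
  | zero =>
    rw [List.eraseIdx_zero, List.tail_cons] at hpe
    rw [← wordProd_cons, ← hpe, simple_mul_simple_cancel_right]
  | succ p =>
    rw [List.eraseIdx_cons_succ, wordProd_cons, wordProd_cons, mul_assoc, mul_right_inj] at hpe
    have h1 := cs.length_wordProd_le (η.eraseIdx p)
    have h2 := List.length_eraseIdx_le η p
    rw [hpe, hη.eq] at hj
    omega

namespace IsSubwordCongruence

variable {r : List (B × Bool) → List (B × Bool) → Prop}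

/-- Parallel bireduced words with the same first letter, selected in exactly one of them, are
related as soon as shorter parallel bireduced words are. -/
theorem rel_cons_true_cons_false (hr : cs.IsSubwordCongruence r) {n : ℕ}
    (hP : ∀ l l' : List (B × Bool), l.length ≤ n → cs.IsBireduced l → cs.IsBireduced l' →
      cs.IsParallel l l' → r l l') {i : B} {l l' : List (B × Bool)} (hn : l.length ≤ n)
    (h : cs.IsBireduced ((i, true) :: l)) (h' : cs.IsBireduced ((i, false) :: l'))
    (hp : cs.IsParallel ((i, true) :: l) ((i, false) :: l')) :
    r ((i, true) :: l) ((i, false) :: l') := by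
  induction hm : l.length generalizing l l' with
  | zero =>
    have hlen := h.length_eq h' hp
    obtain rfl := List.length_eq_zero_iff.1 hm
    obtain rfl : l' = [] := by simpa using hlen
    have h1 : (1 : W) = cs.simple i := by simpa using hp.selected
    have h2 := cs.length_simple i
    rw [← h1, length_one] at h2
    omega
  | succ m ih =>
    obtain ⟨p, ⟨b, ε⟩, rfl⟩ : ∃ p a, l = p ++ [a] :=
      (List.eq_nil_or_concat' l).resolve_left fun h => by simp [h] at hm
    have hword : cs.wordProd ((p ++ [(b, ε)]).map Prod.fst) = cs.wordProd (l'.map Prod.fst) := by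
      simpa [wordProd_cons] using hp.word.symm
    obtain ⟨l₂, hl₂, hr₂, hp₂⟩ := h'.of_cons.exists_isParallel h.of_cons.word hword
    have hlen := h.length_eq h' hp
    simp only [List.length_cons, add_left_inj] at hlen
    refine hr.trans ?_ (hr.symm (hr.cons false rfl (hP _ _ (by omega) h'.of_cons hr₂ hp₂)))
    rw [List.map_append] at hl₂
    obtain ⟨p', l₃, rfl, hpp, hl₃⟩ := List.map_eq_append_iff.1 hl₂
    obtain ⟨⟨b', ε'⟩, rfl, hb'⟩ := List.map_eq_singleton_iff.1 hl₃
    obtain rfl : b' = b := hb'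
    replace h' : cs.IsBireduced ((i, false) :: (p' ++ [(b', ε')])) :=
      h'.congr (hp₂.cons rfl false) (by simpa using h'.of_cons.length_eq hr₂ hp₂)
        (by simpa using h'.of_cons.length_selectedWord_eq hr₂ hp₂)
    replace hp := hp.trans (hp₂.cons rfl false)
    clear hp₂ hl₂ hl₃ hword hlen l' hr₂
    rw [List.length_append, List.length_singleton, add_left_inj] at hm
    have hlen' : p'.length = p.length := by simpa using congrArg List.length hpp
    set y := cs.wordProd (selectedWord (p ++ [(b', ε)])) with hy
    have hy' : cs.wordProd (selectedWord (p' ++ [(b', ε')])) = cs.simple i * y := by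
      simpa only [selectedWord_cons_true, selectedWord_cons_false, wordProd_cons] using hp.selected
    have hsy : cs.length (cs.simple i * y) = cs.length y + 1 := by
      have h1 := h.selected.eq
      rw [selectedWord_cons_true, wordProd_cons, ← hy, List.length_cons,
        ← h.of_cons.selected.eq] at h1
      exact h1
    rcases cs.length_mul_simple y b' with hyb | hyb
    · obtain rfl : ε = false := by
        cases ε with
        | false => rfl
        | true =>
          have h1 := h.of_cons.selected
          have h2 : selectedWord (p ++ [(b', true)]) = selectedWord p ++ [b'] := by simp
          rw [h2] at hy h1
          have := h1.of_append_singleton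
          rw [← hy] at this
          omega
      have hyp : y = cs.wordProd (selectedWord p) := by rw [hy]; simp
      cases ε' with
      | false =>
        refine hr.concat _ (ih (l' := p') (by simp at hn; omega) (h.of_append_left (m := [_]))
          (h'.of_append_left (m := [_])) ⟨?_, ?_⟩ hm)
        · simp [hpp]
        · simpa [hyp, wordProd_cons] using hy'
      | true =>
        have h1 := h'.of_cons.selected
        have h2 : selectedWord (p' ++ [(b', true)]) = selectedWord p' ++ [b'] := by simp
        rw [h2] at hy' h1
        have h3 := h1.of_append_singleton
        rw [hy'] at h3
        have hcomm := simple_mul_eq_mul_simple hsy (by omega) h3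
        rw [hcomm, wordProd_append, wordProd_singleton, mul_left_inj, hyp] at hy'
        refine hr.trans (hr.swap (hyp ▸ hcomm)) (hr.cons false rfl (hr.concat _ ?_))
        refine hP _ _ (by simp at hn; omega) h.of_cons.of_append_left h'.of_cons.of_append_left
          ⟨by rw [hpp], hy'⟩
    · have hlt : cs.length (y * cs.simple b') < cs.length y := by omega
      have hlt' : cs.length (cs.simple i * y * cs.simple b') < cs.length (cs.simple i * y) := by
        have := cs.length_mul_le (cs.simple i) (y * cs.simple b')
        rw [length_simple, ← mul_assoc] at this
        omega
      obtain ⟨q, hq, hqr, hqp⟩ := h.of_cons.exists_select_last hlt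
      obtain ⟨q', hq', hqr', hqp'⟩ := h'.of_cons.exists_select_last (by rwa [hy'])
      have hql : q.length = p.length := by simpa using congrArg List.length hq
      have hql' : q'.length = p'.length := by simpa using congrArg List.length hq'
      refine hr.trans (hr.cons true rfl (hP _ _ hn h.of_cons hqr hqp))
        (hr.trans ?_ (hr.symm (hr.cons false rfl
          (hP _ _ (by simp at hn ⊢; omega) h'.of_cons hqr' hqp'))))
      have hR := h.congr (hqp.cons rfl true) (by simp [hql])
        (by simpa using h.of_cons.length_selectedWord_eq hqr hqp)
      have hR' := h'.congr (hqp'.cons rfl false) (by simp [hql'])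
        (by simpa using h'.of_cons.length_selectedWord_eq hqr' hqp')
      refine hr.concat _ (ih (l := q) (l' := q') (by simp at hn; omega)
        (hR.of_append_left (m := [_])) (hR'.of_append_left (m := [_])) ⟨?_, ?_⟩ (by omega))
      · simp [hq, hq', hpp]
      · have := hqp'.selected
        rw [hy', hy, ← hqp.selected] at this
        simpa [wordProd_append, wordProd_cons, ← mul_assoc] using this

/-- Parallel bireduced words are related by every subword congruence. -/
theorem rel_of_isParallel (hr : cs.IsSubwordCongruence r) {l l' : List (B × Bool)}
    (hl : cs.IsBireduced l) (hl' : cs.IsBireduced l') (hp : cs.IsParallel l l') : r l l' := by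
  suffices H : ∀ n, ∀ l l' : List (B × Bool), l.length ≤ n → cs.IsBireduced l →
      cs.IsBireduced l' → cs.IsParallel l l' → r l l' from H _ l l' le_rfl hl hl' hp
  clear hl hl' hp l l'
  intro n
  induction n with
  | zero =>
    intro l l' hn hl hl' hp
    have hlen := hl.length_eq hl' hp
    obtain rfl : l = [] := by simpa using hn
    obtain rfl : l' = [] := by simpa using hlen
    exact hr.refl _
  | succ n ih =>
    have same : ∀ {l l' : List (B × Bool)} {i j : B} {η ω : List B}, l.length ≤ n + 1 →
        cs.IsBireduced l → cs.IsBireduced l' → cs.IsParallel l l' →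
        l.map Prod.fst = i :: η → l'.map Prod.fst = j :: ω → cs.simple i = cs.simple j →
        r l l' := by
      intro l l' i j η ω hn hl hl' hp hη hω hij
      obtain ⟨⟨i', b⟩, l, rfl, hi', rfl⟩ := List.map_eq_cons_iff.1 hη
      obtain rfl : i' = i := hi'
      obtain ⟨⟨j', b'⟩, l', rfl, hj', rfl⟩ := List.map_eq_cons_iff.1 hω
      obtain rfl : j' = j := hj'
      have hlen := hl.length_eq hl' hp
      simp only [List.length_cons, add_left_inj, add_le_add_iff_right] at hn hlen
      have hw : cs.wordProd (l'.map Prod.fst) = cs.wordProd (l.map Prod.fst) := by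
        simpa [wordProd_cons, hij] using hp.word
      have hpar : cs.IsParallel ((i', b') :: l') ((j', b') :: l') :=
        (IsParallel.refl l').cons hij b'
      have hr' : cs.IsBireduced ((i', b') :: l') :=
        hl'.congr hpar.symm (by simp) (by cases b' <;> simp)
      refine hr.trans ?_ (hr.cons b' hij (hr.refl l'))
      replace hp := hp.trans hpar.symm
      cases b <;> cases b'
      · exact hr.cons _ rfl (ih _ _ hn hl.of_cons hl'.of_cons ⟨hw, hp.selected⟩)
      · exact hr.symm (hr.rel_cons_true_cons_false ih (by omega) hr' hl hp.symm)
      · exact hr.rel_cons_true_cons_false ih hn hl hr' hp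
      · refine hr.cons _ rfl (ih _ _ hn hl.of_cons hl'.of_cons ⟨hw, ?_⟩)
        simpa [wordProd_cons] using hp.selected
    intro l l' hn hl hl' hp
    have hlen := hl.length_eq hl' hp
    cases hlc : l.map Prod.fst with
    | nil =>
      obtain rfl : l = [] := by simpa using hlc
      obtain rfl : l' = [] := by simpa using hlen
      exact hr.refl _
    | cons i η =>
    cases hlc' : l'.map Prod.fst with
    | nil =>
      obtain rfl : l' = [] := by simpa using hlc'
      obtain rfl : l = [] := by simpa using hlen.symm
      exact hr.refl _
    | cons j ω =>
    by_cases hij : cs.simple i = cs.simple j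
    · exact same hn hl hl' hp hlc hlc' hij
    have hi : cs.IsLeftDescent (cs.wordProd (l.map Prod.fst)) i := by
      rw [hlc]
      exact (hlc ▸ hl.word).isLeftDescent
    have hj : cs.IsLeftDescent (cs.wordProd (l.map Prod.fst)) j := by
      rw [← hp.word, hlc']
      exact (hlc' ▸ hl'.word).isLeftDescent
    obtain ⟨k, z, hb, hz, hzr⟩ := cs.exists_wordProd_alternatingFrom_append hi hj hij
    obtain ⟨l₂, hl₂, hr₂, hp₂⟩ := hl.exists_isParallel hzr hz
    obtain ⟨m, m', hm, hm', hmr, hmr', hmp, hmp', hrel⟩ :=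
      hr.exists_rel_alternatingFrom_append hb hr₂ hl₂
    have hlm := hp₂.trans hmp
    have hlm' := hp₂.trans hmp'
    exact hr.trans (same hn hl hmr hlm hlc hm rfl) (hr.trans hrel
      (same (by rw [hl.length_eq hmr' hlm']; exact hn) hmr' hl' (hlm'.symm.trans hp) hm' hlc' rfl))

end IsSubwordCongruence

end CoxeterSystem

section cWord

variable {B W G : Type*} [Group W] [Group G] {M : CoxeterMatrix B} {cs : CoxeterSystem M W}
  {π : G →* W} {σ : W →* RingAut (MonoidAlgebra ℤ π.ker)} {c : G → MonoidAlgebra ℤ π.ker}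

variable (cs π σ c) in
/-- The properties of the coefficients of the quadratic relations of a pro-`p` Iwahori Hecke
ring. -/
structure IsCDatum : Prop where
  comm (a b : π.ker) : a * b = b * a
  smul_of (g : G) (t : π.ker) : σ (π g) (of ℤ π.ker t) = of ℤ π.ker (MulAut.conjNormal g t)
  mul_left (g : G) (hg : cs.IsReflection (π g)) (t : π.ker) : c (↑t * g) = of ℤ π.ker t * c g
  conj (g h : G) (hg : cs.IsReflection (π g)) : c (h * g * h⁻¹) = σ (π h) (c g)
  mul_smul (g : G) (hg : cs.IsReflection (π g)) (x : MonoidAlgebra ℤ π.ker) :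
    c g * x = c g * σ (π g) x

variable (π σ c) in
/-- Equality of the classes of the triples consisting of the product of a marked word, the product
of its selected subword and its coefficient, modulo rescaling by the kernel. -/
def SubwordRel (l l' : List (G × Bool)) : Prop :=
  ∃ a b : π.ker, (l'.map Prod.fst).prod = a * (l.map Prod.fst).prod ∧
    (selectedWord l').prod = b * (selectedWord l).prod ∧
    cWord π σ c l' = of ℤ π.ker (a * b⁻¹) * cWord π σ c l

theorem exists_eq_ker_mul {g g' : G} (h : π g = π g') : ∃ t : π.ker, g' = t * g :=
  ⟨⟨g' * g⁻¹, by simp [MonoidHom.mem_ker, h]⟩, by simp⟩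

theorem cWord_append (l m : List (G × Bool)) :
    cWord π σ c (l ++ m) =
      cWord π σ c l * σ (π (selectedWord l).prod) (cWord π σ c m) := by
  induction l with
  | nil => simp [cWord]
  | cons p l ih =>
    obtain ⟨g, _ | _⟩ := p
    · simp [cWord, ih, mul_assoc]
    · simp [cWord, ih]

theorem cWord_map_mk_true (l : List G) : cWord π σ c (l.map fun g => (g, true)) = 1 := by
  induction l with
  | nil => rfl
  | cons g l ih => simp [cWord, ih]

theorem SubwordRel.refl (l : List (G × Bool)) : SubwordRel π σ c l l :=
  ⟨1, 1, by simp, by simp, by simp [← one_def]⟩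

theorem SubwordRel.concat (p : G × Bool) {l l' : List (G × Bool)} (h : SubwordRel π σ c l l') :
    SubwordRel π σ c (l ++ [p]) (l' ++ [p]) := by
  obtain ⟨a, b, h1, h2, h3⟩ := h
  have h4 : π (selectedWord l').prod = π (selectedWord l).prod := by
    rw [h2, map_mul, MonoidHom.mem_ker.1 b.2, one_mul]
  refine ⟨a, b, by simp [h1, mul_assoc], ?_, by simp only [cWord_append, h3, h4, mul_assoc]⟩
  obtain ⟨g, _ | _⟩ := p <;> simp [h2, mul_assoc]

theorem subwordRel_map_mk_true {l l' : List G} (h : π l.prod = π l'.prod) :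
    SubwordRel π σ c (l.map fun g => (g, true)) (l'.map fun g => (g, true)) := by
  obtain ⟨t, ht⟩ := exists_eq_ker_mul h
  refine ⟨t, t, by simpa only [map_fst_map_mk_true], by simpa only [selectedWord_map_mk_true], ?_⟩
  simp [cWord_map_mk_true, ← one_def]

theorem map_fst_map_prodMap {α β : Type*} (f : α → β) (l : List (α × Bool)) :
    (l.map (Prod.map f id)).map Prod.fst = (l.map Prod.fst).map f := by
  simp [Function.comp_def]

theorem selectedWord_map_prodMap {α β : Type*} (f : α → β) (l : List (α × Bool)) :
    selectedWord (l.map (Prod.map f id)) = (selectedWord l).map f := by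
  induction l with
  | nil => rfl
  | cons p l ih => obtain ⟨a, _ | _⟩ := p <;> simp [ih]

theorem map_prod_map_eq_wordProd {τ : B → G} (hτ : ∀ i, π (τ i) = cs.simple i) (ω : List B) :
    π (ω.map τ).prod = cs.wordProd ω := by
  simp [CoxeterSystem.wordProd, map_list_prod, Function.comp_def, hτ]

namespace IsCDatum

theorem algebra_comm (hd : IsCDatum cs π σ c) (x y : MonoidAlgebra ℤ π.ker) : x * y = y * x := by
  let _ : CommGroup π.ker := { mul_comm := hd.comm }
  exact mul_comm x y

theorem mul_of (hd : IsCDatum cs π σ c) (g : G) (hg : cs.IsReflection (π g)) (t : π.ker) :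
    c g * of ℤ π.ker (MulAut.conjNormal g t) = c g * of ℤ π.ker t := by
  rw [← hd.smul_of, ← hd.mul_smul g hg]

theorem symm (hd : IsCDatum cs π σ c)
    {l l' : List (G × Bool)} (h : SubwordRel π σ c l l') : SubwordRel π σ c l' l := by
  obtain ⟨a, b, h1, h2, h3⟩ := h
  refine ⟨a⁻¹, b⁻¹, by simp [h1], by simp [h2], ?_⟩
  rw [h3, ← mul_assoc, ← map_mul, inv_inv, hd.comm a, mul_assoc, mul_inv_cancel_left]
  simp [← one_def]

theorem trans (hd : IsCDatum cs π σ c) {l l' l'' : List (G × Bool)} (h : SubwordRel π σ c l l')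
    (h' : SubwordRel π σ c l' l'') : SubwordRel π σ c l l'' := by
  obtain ⟨a, b, h1, h2, h3⟩ := h
  obtain ⟨a', b', h1', h2', h3'⟩ := h'
  refine ⟨a' * a, b' * b, by simp [h1, h1', mul_assoc], by simp [h2, h2', mul_assoc], ?_⟩
  rw [h3', h3, ← mul_assoc, ← map_mul, mul_inv_rev, mul_assoc a', mul_assoc a', ← mul_assoc a,
    hd.comm b'⁻¹]

/-- Coefficients do not distinguish the twists by the product and by the selected product. -/
theorem cWord_mul (hd : IsCDatum cs π σ c)
    {l : List (G × Bool)} (hl : ∀ p ∈ l, cs.IsReflection (π p.1))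
    (y : MonoidAlgebra ℤ π.ker) :
    cWord π σ c l * σ (π (selectedWord l).prod) y =
      cWord π σ c l * σ (π (l.map Prod.fst).prod) y := by
  induction l generalizing y with
  | nil => simp
  | cons p l ih =>
    have hg := hl p (by simp)
    have ih := ih fun q hq => hl q (List.mem_cons_of_mem _ hq)
    obtain ⟨g, _ | _⟩ := p
    · rw [selectedWord_cons_false, cWord, mul_assoc, ih, hd.algebra_comm (cWord π σ c l),
        ← mul_assoc, hd.mul_smul g hg, mul_assoc, hd.algebra_comm _ (cWord π σ c l)]
      simp [mul_assoc]
    · simp only [selectedWord_cons_true, cWord, List.prod_cons, List.map_cons, map_mul,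
        RingAut.mul_apply]
      rw [← map_mul, ih, map_mul]

theorem cons (hd : IsCDatum cs π σ c)
    {g g' : G} (b : Bool) {l l' : List (G × Bool)} (hg : cs.IsReflection (π g))
    (hgg : π g = π g') (h : SubwordRel π σ c l l') :
    SubwordRel π σ c ((g, b) :: l) ((g', b) :: l') := by
  obtain ⟨t, rfl⟩ := exists_eq_ker_mul hgg
  obtain ⟨x, y, h1, h2, h3⟩ := h
  cases b with
  | false =>
    refine ⟨t * MulAut.conjNormal g x, y, by simp [h1, mul_assoc], by simpa using h2, ?_⟩
    rw [cWord, cWord, h3, hd.mul_left g hg, map_mul, map_mul, map_mul, mul_assoc, mul_assoc,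
      mul_assoc, mul_assoc]
    congr 1
    rw [← mul_assoc (c g), ← hd.mul_of g hg x, mul_assoc, hd.algebra_comm (c g), mul_assoc,
      mul_assoc, hd.algebra_comm _ (c g)]
  | true =>
    refine ⟨t * MulAut.conjNormal g x, t * MulAut.conjNormal g y, by simp [h1, mul_assoc],
      by simp [h2, mul_assoc], ?_⟩
    rw [cWord, cWord, h3, ← hgg, map_mul, hd.smul_of, hd.comm t, mul_inv_rev, hd.comm _ t⁻¹,
      mul_assoc _ t, mul_inv_cancel_left, map_mul (MulAut.conjNormal g), map_inv]

theorem subwordRel_conj (hd : IsCDatum cs π σ c)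
    {g h : G} {l : List (G × Bool)} (hg : cs.IsReflection (π g))
    (hh : cs.IsReflection (π h)) (hl : ∀ p ∈ l, cs.IsReflection (π p.1))
    (hgh : π g * π (l.map Prod.fst).prod = π (l.map Prod.fst).prod * π h) :
    SubwordRel π σ c ((g, false) :: l) (l ++ [(h, false)]) := by
  rw [← map_mul, ← map_mul] at hgh
  obtain ⟨t, ht⟩ := exists_eq_ker_mul hgh
  refine ⟨t, 1, by simpa using ht, by simp, ?_⟩
  have hc : σ (π (l.map Prod.fst).prod) (c h) = of ℤ π.ker t * c g := by
    rw [← hd.conj _ _ hh, ht, ← mul_assoc, mul_inv_cancel_right, hd.mul_left g hg]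
  rw [cWord_append, hd.cWord_mul hl]
  simp only [cWord, mul_one, hc, inv_one]
  rw [hd.algebra_comm, mul_assoc]

theorem subwordRel_swap (hd : IsCDatum cs π σ c)
    {g h : G} {l : List (G × Bool)} (hg : cs.IsReflection (π g))
    (hh : cs.IsReflection (π h))
    (hgh : π g * π (selectedWord l).prod = π (selectedWord l).prod * π h) :
    SubwordRel π σ c ((g, true) :: (l ++ [(h, false)])) ((g, false) :: (l ++ [(h, true)])) := by
  rw [← map_mul, ← map_mul] at hgh
  obtain ⟨t, ht⟩ := exists_eq_ker_mul hgh
  refine ⟨1, t, by simp, by simpa using ht, ?_⟩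
  have hc : σ (π (selectedWord l).prod) (c h) = of ℤ π.ker t * c g := by
    rw [← hd.conj _ _ hh, ht, ← mul_assoc, mul_inv_cancel_right, hd.mul_left g hg]
  have hgg : σ (π g) (c g) = c g := by rw [← hd.conj g g hg, mul_inv_cancel_right]
  simp only [cWord, cWord_append, mul_one, hc, one_mul, map_one]
  rw [hd.algebra_comm (cWord π σ c l), mul_assoc, map_mul, map_mul, hgg, ← hd.mul_smul g hg,
    ← mul_assoc]
  have key : σ (π g) (of ℤ π.ker t) * c g = of ℤ π.ker t * c g := by
    rw [hd.algebra_comm, ← hd.mul_smul g hg, hd.algebra_comm]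
  rw [mul_assoc (of ℤ π.ker t⁻¹), ← mul_assoc (σ _ _) (c g), key, mul_assoc, ← mul_assoc,
    ← map_mul, inv_mul_cancel, map_one, one_mul]

theorem isSubwordCongruence (hd : IsCDatum cs π σ c) {τ : B → G} (hτ : ∀ i, π (τ i) = cs.simple i) :
    cs.IsSubwordCongruence fun l l' =>
      SubwordRel π σ c (l.map (Prod.map τ id)) (l'.map (Prod.map τ id)) := by
  have hrefl : ∀ i, cs.IsReflection (π (τ i)) := fun i => hτ i ▸ cs.isReflection_simple i
  refine ⟨fun _ => .refl _, hd.symm, hd.trans, ?_, ?_, ?_, ?_, ?_⟩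
  · intro i j b l l' hij h
    exact hd.cons b (hrefl i) (by rw [hτ, hτ, hij]) h
  · intro a l l' h
    simpa using h.concat (Prod.map τ id a)
  · intro i j l h
    have hl : ∀ p ∈ l.map (Prod.map τ id), cs.IsReflection (π p.1) := by
      intro p hp
      obtain ⟨q, -, rfl⟩ := List.mem_map.1 hp
      exact hrefl q.1
    simpa using hd.subwordRel_conj (hrefl i) (hrefl j) hl
      (by rw [map_fst_map_prodMap, map_prod_map_eq_wordProd hτ, hτ, hτ, h])
  · intro i j l h
    simpa using hd.subwordRel_swap (l := l.map (Prod.map τ id)) (hrefl i) (hrefl j)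
      (by rw [selectedWord_map_prodMap, map_prod_map_eq_wordProd hτ, hτ, hτ, h])
  · intro ω ω' h
    have := subwordRel_map_mk_true (σ := σ) (c := c) (l := ω.map τ) (l' := ω'.map τ)
      (by rw [map_prod_map_eq_wordProd hτ, map_prod_map_eq_wordProd hτ, h])
    simpa [Function.comp_def] using this

theorem exists_subwordRel_map (hd : IsCDatum cs π σ c) {τ : B → G} (hτ : ∀ i, π (τ i) = cs.simple i)
    {l : List (G × Bool)} (hl : ∀ p ∈ l, ∃ i : B, π p.1 = cs.simple i) :
    ∃ m : List (B × Bool), m.length = l.length ∧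
      (selectedWord m).length = (selectedWord l).length ∧
      SubwordRel π σ c l (m.map (Prod.map τ id)) := by
  induction l with
  | nil => exact ⟨[], rfl, rfl, .refl _⟩
  | cons p l ih =>
    obtain ⟨m, h1, h2, h3⟩ := ih fun q hq => hl q (List.mem_cons_of_mem _ hq)
    obtain ⟨g, b⟩ := p
    obtain ⟨i, hi⟩ := hl (g, b) (by simp)
    refine ⟨(i, b) :: m, by simp [h1], by cases b <;> simp [h2], ?_⟩
    exact hd.cons b (hi ▸ cs.isReflection_simple i) (by rw [hi, hτ]) h3

/-- Marked words with the same products modulo the kernel have the same class. -/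
theorem subwordRel_of_map_eq (hd : IsCDatum cs π σ c)
    (hπ : Function.Surjective π) {l l' : List (G × Bool)}
    (hl : ∀ p ∈ l, ∃ i : B, π p.1 = cs.simple i) (hl' : ∀ p ∈ l', ∃ i : B, π p.1 = cs.simple i)
    (hred : cs.length (π (l.map Prod.fst).prod) = l.length)
    (hred' : cs.length (π (l'.map Prod.fst).prod) = l'.length)
    (hsel : cs.length (π (selectedWord l).prod) = (selectedWord l).length)
    (hsel' : cs.length (π (selectedWord l').prod) = (selectedWord l').length)
    (hw : π (l'.map Prod.fst).prod = π (l.map Prod.fst).prod)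
    (hx : π (selectedWord l').prod = π (selectedWord l).prod) : SubwordRel π σ c l l' := by
  choose τ hτ using fun i => hπ (cs.simple i)
  have key : ∀ {l : List (G × Bool)} {m : List (B × Bool)},
      SubwordRel π σ c l (m.map (Prod.map τ id)) →
      cs.wordProd (m.map Prod.fst) = π (l.map Prod.fst).prod ∧
      cs.wordProd (selectedWord m) = π (selectedWord l).prod := by
    rintro l m ⟨a, b, h1, h2, -⟩
    rw [← map_prod_map_eq_wordProd hτ, ← map_prod_map_eq_wordProd hτ, ← map_fst_map_prodMap,
      ← selectedWord_map_prodMap, h1, h2, map_mul, map_mul, MonoidHom.mem_ker.1 a.2,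
      MonoidHom.mem_ker.1 b.2, one_mul, one_mul]
    exact ⟨rfl, rfl⟩
  obtain ⟨m, h1, h2, h3⟩ := hd.exists_subwordRel_map hτ hl
  obtain ⟨m', h1', h2', h3'⟩ := hd.exists_subwordRel_map hτ hl'
  obtain ⟨k1, k2⟩ := key h3
  obtain ⟨k1', k2'⟩ := key h3'
  refine hd.trans h3 (hd.trans ?_ (hd.symm h3'))
  refine (hd.isSubwordCongruence hτ).rel_of_isParallel ⟨?_, ?_⟩ ⟨?_, ?_⟩ ⟨?_, ?_⟩
  · rw [CoxeterSystem.IsReduced, k1, hred, List.length_map, h1]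
  · rw [CoxeterSystem.IsReduced, k2, hsel, h2]
  · rw [CoxeterSystem.IsReduced, k1', hred', List.length_map, h1']
  · rw [CoxeterSystem.IsReduced, k2', hsel', h2']
  · rw [k1, k1', hw]
  · rw [k2, k2', hx]

end IsCDatum

end cWord

/-- The well-definedness proposition of Section 4.4 of the paper: if `w̄, w̄'` are reduced
words in letters lifting simple reflections with reduced selected subwords having the same
length data, and `t·(product of w̄) = t'·(product of w̄')`,
`u·(product of selected subword of w̄) = u'·(product of selected subword of w̄')`, then
`t·u⁻¹·c(w̄;ī) = t'·u'⁻¹·c(w̄';ī')` in `ℤ[T]`: the element `t·u⁻¹·c(w̄;ī)` depends only on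
the pair of group elements. -/
theorem cWord_well_defined {B W G : Type*} [Group W] [Group G] {M : CoxeterMatrix B}
    (cs : CoxeterSystem M W) (π : G →* W) (hπ : Function.Surjective π)
    (hT : ∀ a b : π.ker, a * b = b * a)
    (σ : W →* RingAut (MonoidAlgebra ℤ π.ker))
    (hσ : ∀ (g : G) (t : π.ker),
      σ (π g) (MonoidAlgebra.of ℤ π.ker t) =
        MonoidAlgebra.of ℤ π.ker ⟨g * t * g⁻¹, (MonoidHom.normal_ker π).conj_mem t t.2 g⟩)
    (c : G → MonoidAlgebra ℤ π.ker)
    (hc_a : ∀ g : G, cs.IsReflection (π g) → ∀ t : π.ker,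
      c (↑t * g) = MonoidAlgebra.of ℤ π.ker t * c g)
    (hc_b : ∀ g h : G, cs.IsReflection (π g) → c (h * g * h⁻¹) = σ (π h) (c g))
    (hc_c : ∀ g : G, cs.IsReflection (π g) →
      ∀ x : MonoidAlgebra ℤ π.ker, c g * x = c g * σ (π g) x)
    (l l' : List (G × Bool)) (t u t' u' : π.ker)
    (hl : ∀ p ∈ l, ∃ i : B, π p.1 = cs.simple i)
    (hl' : ∀ p ∈ l', ∃ i : B, π p.1 = cs.simple i)
    (hlen : l.length = l'.length)
    (hsellen : (l.filter fun p => p.2).length = (l'.filter fun p => p.2).length)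
    (hred : cs.length (π ((l.map Prod.fst).prod)) = l.length)
    (hred' : cs.length (π ((l'.map Prod.fst).prod)) = l'.length)
    (hselred : cs.length (π (((l.filter fun p => p.2).map Prod.fst).prod)) =
      (l.filter fun p => p.2).length)
    (hselred' : cs.length (π (((l'.filter fun p => p.2).map Prod.fst).prod)) =
      (l'.filter fun p => p.2).length)
    (hw : (↑t : G) * (l.map Prod.fst).prod = (↑t' : G) * (l'.map Prod.fst).prod)
    (hx : (↑u : G) * ((l.filter fun p => p.2).map Prod.fst).prod =
      (↑u' : G) * ((l'.filter fun p => p.2).map Prod.fst).prod) :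
    MonoidAlgebra.of ℤ π.ker (t * u⁻¹) * cWord π σ c l =
      MonoidAlgebra.of ℤ π.ker (t' * u'⁻¹) * cWord π σ c l' := by
  have hd : IsCDatum cs π σ c := by
    refine ⟨hT, fun g t => (hσ g t).trans ?_, hc_a, fun g h => hc_b g h, hc_c⟩
    congr 1
  have hπu : ∀ (a b : π.ker) (g h : G), (a : G) * g = b * h → π h = π g := by
    intro a b g h e
    simpa [MonoidHom.mem_ker.1 a.2, MonoidHom.mem_ker.1 b.2] using (congrArg π e).symm
  obtain ⟨a, b, h1, h2, h3⟩ := hd.subwordRel_of_map_eq hπ hl hl' hred hred'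
    (by rw [selectedWord, hselred, List.length_map])
    (by rw [selectedWord, hselred', List.length_map]) (hπu _ _ _ _ hw) (hπu _ _ _ _ hx)
  have ht : t = t' * a := by
    rw [h1, ← mul_assoc, mul_left_inj] at hw
    exact Subtype.ext hw
  have hu : u = u' * b := by
    rw [← selectedWord, ← selectedWord, h2, ← mul_assoc, mul_left_inj] at hx
    exact Subtype.ext hx
  rw [h3, ← mul_assoc, ← map_mul, ht, hu, mul_inv_rev, mul_assoc t', mul_assoc t', ← mul_assoc a,
    hT (a * b⁻¹)]
end

section
/- Let Γ be a finite group and X a ℤ[Γ]-module that is finitely generated and free as a ℤ-module. Let X* = Hom_ℤ(X, ℤ), with Γ acting by (γ·f)(x) = f(γ⁻¹·x), and let (X*)_Γ denote the coinvariants of X*, i.e. the quotient of X* by the subgroup generated by all elements γ·f − f. Then the first group cohomology H¹(Γ, X) is a finite abelian group isomorphic to the torsion subgroup of (X*)_Γ. (This is the duality claim in the proof of the Appendix lemma on maximal compactness: for a profinite group Γ acting smoothly on a finite free ℤ-module X, the finite groups H¹(Γ, X) and Hom_Γ(X,ℤ)_tor are dual; here stated for finite Γ, to which the paper reduces by inflation-restriction.)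 -/
/-- The submodule of relations defining the coinvariants of a representation: the span of
all elements `γ·m − m`. The coinvariants are the quotient by this submodule. -/
def coinvariantsRel {Γ : Type} [Group Γ] {M : Type} [AddCommGroup M] [Module ℤ M]
    (ρ : Representation ℤ Γ M) : Submodule ℤ M :=
  Submodule.span ℤ {x | ∃ (γ : Γ) (m : M), x = ρ γ m - m}

/-- Two linear maps with the same kernel have isomorphic ranges. -/
theorem LinearMap.nonempty_range_equiv_of_ker_eq {R P A B : Type*} [CommRing R]
    [AddCommGroup P] [AddCommGroup A] [AddCommGroup B] [Module R P] [Module R A] [Module R B]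
    {f : P →ₗ[R] A} {g : P →ₗ[R] B} (h : LinearMap.ker f = LinearMap.ker g) :
    Nonempty (LinearMap.range f ≃ₗ[R] LinearMap.range g) :=
  ⟨f.quotKerEquivRange.symm ≪≫ₗ Submodule.quotEquivOfEq _ _ h ≪≫ₗ g.quotKerEquivRange⟩

namespace Module.Basis.SmithNormalForm

variable {R M : Type*} [CommRing R] [AddCommGroup M] [Module R M]
  {N : Submodule R M} {ι : Type*} {n : ℕ} (s : Module.Basis.SmithNormalForm N ι n)

include s in
theorem a_ne_zero [Nontrivial R] (i : Fin n) : s.a i ≠ 0 := by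
  intro h
  have h1 := s.snf i
  rw [h, zero_smul] at h1
  exact s.bN.ne_zero i (Subtype.ext h1)

/-- The map `Rⁿ → M ⧸ N` given by the basis vectors of `M` lying in the saturation of `N`. -/
noncomputable def saturationMap : (Fin n → R) →ₗ[R] M ⧸ N :=
  N.mkQ ∘ₗ Fintype.linearCombination R (fun i => s.bM (s.f i))

theorem saturationMap_apply (c : Fin n → R) :
    s.saturationMap c = N.mkQ (∑ i, c i • s.bM (s.f i)) := by
  simp [saturationMap, Fintype.linearCombination_apply]

theorem coe_eq_sum (y : N) : (y : M) = ∑ i, (s.bN.repr y i * s.a i) • s.bM (s.f i) := by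
  simp_rw [mul_smul, ← s.snf, ← Submodule.coe_smul, ← Submodule.coe_sum, s.bN.sum_repr]

theorem repr_sum_smul (c : Fin n → R) (i : Fin n) :
    s.bM.repr (∑ j, c j • s.bM (s.f j)) (s.f i) = c i := by
  classical
  simp [Finsupp.single_apply]

theorem sum_smul_mem_iff (c : Fin n → R) :
    ∑ i, c i • s.bM (s.f i) ∈ N ↔ ∀ i, s.a i ∣ c i := by
  constructor
  · intro h i
    have h1 := s.coe_eq_sum ⟨_, h⟩
    have h2 := congrArg (fun y => s.bM.repr y (s.f i)) h1
    simp only [repr_sum_smul] at h2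
    exact ⟨_, h2.trans (mul_comm _ _)⟩
  · intro h
    refine Submodule.sum_mem _ fun i _ => ?_
    obtain ⟨d, hd⟩ := h i
    rw [hd, mul_comm, mul_smul, ← s.snf]
    exact N.smul_mem _ (s.bN i).2

theorem mem_ker_saturationMap (c : Fin n → R) :
    c ∈ LinearMap.ker s.saturationMap ↔ ∀ i, s.a i ∣ c i := by
  rw [LinearMap.mem_ker, saturationMap_apply, Submodule.mkQ_apply,
    Submodule.Quotient.mk_eq_zero, sum_smul_mem_iff]

theorem range_saturationMap [IsDomain R] :
    LinearMap.range s.saturationMap = Submodule.torsion R (M ⧸ N) := by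
  apply le_antisymm
  · rintro _ ⟨c, rfl⟩
    rw [Submodule.mem_torsion_iff]
    refine ⟨⟨∏ i, s.a i, mem_nonZeroDivisors_of_ne_zero
      (Finset.prod_ne_zero_iff.2 fun i _ => s.a_ne_zero i)⟩, ?_⟩
    change (∏ i, s.a i) • s.saturationMap c = 0
    rw [← map_smul, ← LinearMap.mem_ker, mem_ker_saturationMap]
    intro i
    exact (Finset.dvd_prod_of_mem s.a (Finset.mem_univ i)).mul_right _
  · intro q hq
    obtain ⟨y, rfl⟩ := N.mkQ_surjective q
    obtain ⟨⟨k, hk⟩, h⟩ := (Submodule.mem_torsion_iff _).1 hq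
    change k • N.mkQ y = 0 at h
    rw [← map_smul, Submodule.mkQ_apply, Submodule.Quotient.mk_eq_zero] at h
    have h1 := s.coe_eq_sum ⟨_, h⟩
    have hk0 : k ≠ 0 := nonZeroDivisors.ne_zero hk
    refine ⟨fun i => s.bM.repr y (s.f i), ?_⟩
    rw [saturationMap_apply]
    congr 1
    apply s.bM.ext_elem
    intro j
    by_cases hj : ∃ i, s.f i = j
    · obtain ⟨i, rfl⟩ := hj
      rw [repr_sum_smul]
    · have h2 := congrArg (fun y => s.bM.repr y j) h1
      have h3 : ∀ i, s.f i ≠ j := fun i hi => hj ⟨i, hi⟩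
      simp [h3] at h2
      simp [h3, h2.resolve_left hk0]

end Module.Basis.SmithNormalForm

namespace LinearMap

variable {R X Y : Type*} [CommRing R] [AddCommGroup X] [Module R X]
  [AddCommGroup Y] [Module R Y] (L : X →ₗ[R] Y) {ι : Type*} {n : ℕ}
  (s : Module.Basis.SmithNormalForm (LinearMap.range L) ι n)

/-- The functional on `X` with coordinates `c` with respect to the basis of the image of `L`. -/
noncomputable def rangeFunctional : (Fin n → R) →ₗ[R] Module.Dual R X :=
  Fintype.linearCombination R (fun i => s.bN.coord i ∘ₗ L.rangeRestrict)

theorem rangeFunctional_apply (c : Fin n → R) (x : X) :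
    L.rangeFunctional s c x = ∑ i, c i * s.bN.repr (L.rangeRestrict x) i := by
  simp [rangeFunctional, Fintype.linearCombination_apply]

theorem rangeFunctional_mem_iff (c : Fin n → R) :
    L.rangeFunctional s c ∈ LinearMap.range L.dualMap ↔ ∀ i, s.a i ∣ c i := by
  constructor
  · rintro ⟨h, hh⟩ i
    obtain ⟨x, hx⟩ := L.surjective_rangeRestrict (s.bN i)
    have h1 := LinearMap.congr_fun hh x
    have h2 : L x = s.a i • s.bM (s.f i) := by
      rw [← s.snf, ← hx]; rfl
    rw [rangeFunctional_apply, hx, LinearMap.dualMap_apply, h2] at h1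
    simp [Finsupp.single_apply] at h1
    exact ⟨_, h1.symm⟩
  · intro h
    choose d hd using h
    refine ⟨∑ i, d i • s.bM.coord (s.f i), ?_⟩
    ext x
    have h2 := s.coe_eq_sum (L.rangeRestrict x)
    have h3 : ((L.rangeRestrict x : LinearMap.range L) : Y) = L x := rfl
    rw [rangeFunctional_apply, LinearMap.dualMap_apply, ← h3, h2, LinearMap.sum_apply]
    refine Finset.sum_congr rfl fun i _ => ?_
    rw [LinearMap.smul_apply, Module.Basis.coord_apply, s.repr_sum_smul, hd, smul_eq_mul]
    ring

theorem mem_ker_mkQ_comp_rangeFunctional (c : Fin n → R) :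
    c ∈ LinearMap.ker ((LinearMap.range L.dualMap).mkQ ∘ₗ L.rangeFunctional s) ↔
      ∀ i, s.a i ∣ c i := by
  rw [LinearMap.mem_ker, LinearMap.comp_apply, Submodule.mkQ_apply,
    Submodule.Quotient.mk_eq_zero, rangeFunctional_mem_iff]

theorem range_mkQ_comp_rangeFunctional [IsDomain R] :
    LinearMap.range ((LinearMap.range L.dualMap).mkQ ∘ₗ L.rangeFunctional s) =
      Submodule.torsion R (Module.Dual R X ⧸ LinearMap.range L.dualMap) := by
  apply le_antisymm
  · rintro _ ⟨c, rfl⟩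
    rw [Submodule.mem_torsion_iff]
    refine ⟨⟨∏ i, s.a i, mem_nonZeroDivisors_of_ne_zero
      (Finset.prod_ne_zero_iff.2 fun i _ => s.a_ne_zero i)⟩, ?_⟩
    rw [Submonoid.mk_smul, ← map_smul, ← LinearMap.mem_ker, mem_ker_mkQ_comp_rangeFunctional]
    intro i
    exact (Finset.dvd_prod_of_mem s.a (Finset.mem_univ i)).mul_right _
  · intro q hq
    obtain ⟨g, rfl⟩ := (LinearMap.range L.dualMap).mkQ_surjective q
    obtain ⟨⟨k, hk⟩, h⟩ := (Submodule.mem_torsion_iff _).1 hq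
    rw [Submonoid.mk_smul, ← map_smul, Submodule.mkQ_apply, Submodule.Quotient.mk_eq_zero] at h
    obtain ⟨h, hh⟩ := h
    have hk0 : k ≠ 0 := nonZeroDivisors.ne_zero hk
    have hker : ∀ x, L x = 0 → g x = 0 := by
      intro x hx
      have h1 := LinearMap.congr_fun hh x
      rw [LinearMap.dualMap_apply, hx, map_zero, LinearMap.smul_apply, smul_eq_mul] at h1
      exact (mul_eq_zero.1 h1.symm).resolve_left hk0
    choose x hx using fun i => L.surjective_rangeRestrict (s.bN i)
    refine ⟨fun i => g (x i), ?_⟩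
    rw [LinearMap.comp_apply]
    congr 1
    ext z
    rw [rangeFunctional_apply]
    have h2 : g (z - ∑ i, s.bN.repr (L.rangeRestrict z) i • x i) = 0 := by
      apply hker
      have h3 : L.rangeRestrict (z - ∑ i, s.bN.repr (L.rangeRestrict z) i • x i) = 0 := by
        simp only [map_sub, map_sum, map_smul, hx]
        rw [s.bN.sum_repr, sub_self]
      exact congrArg Subtype.val h3
    rw [map_sub, map_sum, sub_eq_zero] at h2
    rw [h2]
    refine Finset.sum_congr rfl fun i _ => ?_
    rw [map_smul, smul_eq_mul, mul_comm]

/-- The cokernels of a linear map into a finite free module over a PID and of its transpose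
have isomorphic torsion submodules. -/
theorem nonempty_torsion_coker_equiv_torsion_coker_dualMap [IsDomain R] [IsPrincipalIdealRing R]
    [Module.Free R Y] [Module.Finite R Y] :
    Nonempty (Submodule.torsion R (Y ⧸ LinearMap.range L) ≃ₗ[R]
      Submodule.torsion R (Module.Dual R X ⧸ LinearMap.range L.dualMap)) := by
  obtain ⟨n, s⟩ := Submodule.smithNormalForm (Module.Free.chooseBasis R Y) (LinearMap.range L)
  rw [← s.range_saturationMap, ← L.range_mkQ_comp_rangeFunctional s]
  apply nonempty_range_equiv_of_ker_eq
  ext c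
  rw [s.mem_ker_saturationMap, mem_ker_mkQ_comp_rangeFunctional]

end LinearMap

namespace groupCohomology

universe u

variable {R G : Type u} [CommRing R] [Group G] (A : Rep.{u} R G)

/-- Multiplication by the order of a finite group maps 1-cocycles to 1-coboundaries. -/
theorem card_smul_mem_coboundaries₁ [Finite G] (f : cocycles₁ A) :
    (Nat.card G : R) • (f : G → A) ∈ coboundaries₁ A := by
  have := Fintype.ofFinite G
  refine ⟨-∑ h, f h, ?_⟩
  funext g
  have hf := (mem_cocycles₁_iff (f : G → A)).1 f.2 g
  have h1 : ∑ h, f h = ∑ h, f (g * h) := (Equiv.sum_comp (Equiv.mulLeft g) (fun h => f h)).symm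
  have h2 : ∑ h, f (g * h) = A.ρ g (∑ h, f h) + (Nat.card G : R) • f g := by
    rw [map_sum]
    refine (Finset.sum_congr rfl fun h _ => hf h).trans ?_
    rw [Finset.sum_add_distrib]
    simp [Nat.cast_smul_eq_nsmul]
  change A.ρ g (-∑ h, f h) - (-∑ h, f h) = (Nat.card G : R) • f g
  rw [map_neg]
  rw [← h1] at h2
  nth_rw 2 [h2]
  abel

/-- The 1-cocycles modulo 1-coboundaries are the torsion of the cochains modulo 1-coboundaries. -/
theorem range_mkQ_comp_subtype_cocycles₁ [IsDomain R] [Finite G] [CharZero R] [Module.IsTorsionFree R A] :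
    LinearMap.range ((LinearMap.range (d₀₁ A).hom).mkQ ∘ₗ (cocycles₁ A).subtype) =
      Submodule.torsion R ((G → A) ⧸ LinearMap.range (d₀₁ A).hom) := by
  apply le_antisymm
  · rintro _ ⟨f, rfl⟩
    rw [Submodule.mem_torsion_iff]
    refine ⟨⟨(Nat.card G : R), mem_nonZeroDivisors_of_ne_zero
      (Nat.cast_ne_zero.2 Nat.card_pos.ne')⟩, ?_⟩
    rw [Submonoid.mk_smul, LinearMap.comp_apply, ← map_smul, Submodule.mkQ_apply,
      Submodule.Quotient.mk_eq_zero]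
    exact card_smul_mem_coboundaries₁ A f
  · intro q hq
    obtain ⟨y, rfl⟩ := (LinearMap.range (d₀₁ A).hom).mkQ_surjective q
    obtain ⟨⟨k, hk⟩, h⟩ := (Submodule.mem_torsion_iff _).1 hq
    rw [Submonoid.mk_smul, ← map_smul, Submodule.mkQ_apply, Submodule.Quotient.mk_eq_zero] at h
    have h1 : k • y ∈ cocycles₁ A := coboundaries₁_le_cocycles₁ A h
    have hk0 : k ≠ 0 := nonZeroDivisors.ne_zero hk
    have h2 : y ∈ cocycles₁ A := by
      rw [mem_cocycles₁_def] at h1 ⊢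
      intro a b
      have h3 := h1 a b
      simp only [Pi.smul_apply, map_smul, ← smul_sub, ← smul_add] at h3
      exact (smul_eq_zero.1 h3).resolve_left hk0
    exact ⟨⟨y, h2⟩, rfl⟩

/-- For torsion-free coefficients over a domain of characteristic zero, `H¹` of a finite group is
the torsion submodule of the cokernel of the zeroth differential. -/
theorem nonempty_H1_equiv_torsion_coker [IsDomain R] [Finite G] [CharZero R] [Module.IsTorsionFree R A] :
    Nonempty (H1 A ≃ₗ[R] Submodule.torsion R ((G → A) ⧸ LinearMap.range (d₀₁ A).hom)) := by
  have hsurj : LinearMap.range (H1π A).hom = ⊤ :=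
    LinearMap.range_eq_top.2 ((ModuleCat.epi_iff_surjective _).1 inferInstance)
  have hker : LinearMap.ker (H1π A).hom =
      LinearMap.ker ((LinearMap.range (d₀₁ A).hom).mkQ ∘ₗ (cocycles₁ A).subtype) := by
    ext f
    rw [LinearMap.mem_ker, LinearMap.mem_ker, LinearMap.comp_apply, Submodule.mkQ_apply,
      Submodule.Quotient.mk_eq_zero]
    exact H1π_eq_zero_iff f
  obtain ⟨e⟩ := LinearMap.nonempty_range_equiv_of_ker_eq hker
  exact ⟨(LinearEquiv.ofTop _ hsurj).symm ≪≫ₗ e ≪≫ₗ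
    LinearEquiv.ofEq _ _ (range_mkQ_comp_subtype_cocycles₁ A)⟩

/-- The relations defining the coinvariants of the dual are the image of the transpose of the
zeroth differential. -/
theorem range_dualMap_d₀₁ [Finite G] {V : Type u} [AddCommGroup V] [Module R V]
    (ρ : Representation R G V) :
    LinearMap.range (d₀₁ (Rep.of ρ)).hom.dualMap =
      Submodule.span R {x | ∃ (g : G) (f : Module.Dual R V), x = ρ.dual g f - f} := by
  classical
  have := Fintype.ofFinite G
  apply le_antisymm
  · rintro _ ⟨F, rfl⟩
    have h : (d₀₁ (Rep.of ρ)).hom.dualMap F = ∑ g : G,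
        (ρ.dual g⁻¹ (F ∘ₗ LinearMap.single R (fun _ : G => V) g) -
          F ∘ₗ LinearMap.single R (fun _ : G => V) g) := by
      ext x
      have h1 : (d₀₁ (Rep.of ρ)).hom x =
          ∑ g : G, Pi.single (M := fun _ => V) g (ρ g x - x) :=
        (Finset.univ_sum_single (fun g : G => ρ g x - x)).symm
      rw [LinearMap.dualMap_apply, h1, LinearMap.sum_apply]
      refine (map_sum F _ _).trans (Finset.sum_congr rfl fun g _ => ?_)
      rw [Pi.single_sub]
      refine (map_sub F _ _).trans ?_
      simp [Representation.dual_apply, Module.Dual.transpose_apply]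
    rw [h]
    exact Submodule.sum_mem _ fun g _ => Submodule.subset_span ⟨_, _, rfl⟩
  · refine Submodule.span_le.2 ?_
    rintro _ ⟨g, f, rfl⟩
    refine ⟨f ∘ₗ LinearMap.proj g⁻¹, ?_⟩
    ext x
    exact map_sub f (ρ g⁻¹ x) x

/-- For a lattice over a PID of characteristic zero with an action of a finite group, `H¹` is
finitely generated, torsion, and isomorphic to the torsion of the coinvariants of the dual. -/
theorem H1_finite_isTorsion_equiv_torsion_dual_coinvariants [IsDomain R] [IsPrincipalIdealRing R]
    [CharZero R] [Finite G] {V : Type u} [AddCommGroup V] [Module R V] [Module.Free R V]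
    [Module.Finite R V] (ρ : Representation R G V) :
    Module.Finite R (H1 (Rep.of ρ)) ∧ Module.IsTorsion R (H1 (Rep.of ρ)) ∧
      Nonempty (H1 (Rep.of ρ) ≃ₗ[R] Submodule.torsion R (Module.Dual R V ⧸
        Submodule.span R {x | ∃ (g : G) (f : Module.Dual R V), x = ρ.dual g f - f})) := by
  have : Module.Free R (G → Rep.of ρ) := inferInstanceAs (Module.Free R (G → V))
  have : Module.Finite R (G → Rep.of ρ) := inferInstanceAs (Module.Finite R (G → V))
  have : Module.IsTorsionFree R (Rep.of ρ) := inferInstanceAs (Module.IsTorsionFree R V)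
  obtain ⟨e₁⟩ := nonempty_H1_equiv_torsion_coker (Rep.of ρ)
  obtain ⟨e₂⟩ := LinearMap.nonempty_torsion_coker_equiv_torsion_coker_dualMap
    (d₀₁ (Rep.of ρ)).hom
  refine ⟨Module.Finite.equiv e₁.symm, fun {x} => ?_, ?_⟩
  · obtain ⟨a, ha⟩ := Submodule.torsion_isTorsion (x := e₁ x)
    exact ⟨a, e₁.injective (by rw [map_zero, ← ha]; exact map_smul e₁ (a : R) x)⟩
  · rw [← range_dualMap_d₀₁ ρ]
    exact ⟨e₁ ≪≫ₗ e₂⟩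

end groupCohomology

/-- The duality claim in the proof of the Appendix lemma on maximal compactness: for a
finite group `Γ` and a `ℤ[Γ]`-module `X` that is finitely generated and free over `ℤ`,
the first group cohomology `H¹(Γ, X)` is a finite abelian group isomorphic to the torsion
subgroup of the coinvariants `(X*)_Γ` of the dual module `X* = Hom_ℤ(X, ℤ)`, where `Γ`
acts on `X*` by `(γ·f)(x) = f(γ⁻¹·x)`. -/
theorem h1_finite_iso_torsion_of_dual_coinvariants
    {Γ : Type} [Group Γ] [Finite Γ]
    {X : Type} [AddCommGroup X] [Module ℤ X]
    [Module.Free ℤ X] [Module.Finite ℤ X]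
    (ρ : Representation ℤ Γ X) :
    Finite (groupCohomology (Rep.of ρ) 1) ∧
      Nonempty ((groupCohomology (Rep.of ρ) 1) ≃+
        (Submodule.torsion ℤ ((Module.Dual ℤ X) ⧸ coinvariantsRel ρ.dual))) := by
  obtain ⟨_, htors, ⟨e⟩⟩ :=
    groupCohomology.H1_finite_isTorsion_equiv_torsion_dual_coinvariants ρ
  exact ⟨Module.finite_of_fg_torsion _ htors, ⟨e.toAddEquiv⟩⟩
end
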